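/- Suppose a double complex of complex vector spaces satisfies the d'd''-lemma at every (p,q) ∈ ℤ². Then for every (p,q) the natural maps H_{BC}^{p,q} → H_{d'}^{p,q}, H_{BC}^{p,q} → H_{d''}^{p,q}, H_{d'}^{p,q} → H_A^{p,q} and H_{d''}^{p,q} → H_A^{p,q} (induced by the inclusions of the relevant kernels and images) are all isomorphisms. Equivalently, at every (p,q): Im d' ∩ ker d'' ∩ A^{p,q} = Im d'd'' ∩ A^{p,q}; ker d' ∩ Im d'' ∩ A^{p,q} = Im d'd'' ∩ A^{p,q}; ker d' ∩ A^{p,q} = ((ker d' ∩ ker d'') + Im d') ∩ A^{p,q}; ker d'' ∩ A^{p,q} = ((ker d' ∩ ker d'') + Im d'') ∩ A^{p,q}; ker d' ∩ (Im d' + Im d'') ∩ A^{p,q} = Im d' ∩ A^{p,q}; ker d'' ∩ (Im d' + Im d'') ∩ A^{p,q} = Im d'' ∩ A^{p,q}; ker d'd'' ∩ A^{p,q} = (ker d' + Im d'') ∩ A^{p,q}; and ker d'd'' ∩ A^{p,q} = (Im d' + ker d'') ∩ A^{p,q}. -/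

import Mathlib

open Submodule

/-- A double complex of complex vector spaces, realized as an internally bigraded
module `W = ⊕_{p,q} A p q` together with global differentials `d'`, `d''` of
bidegrees `(1,0)` and `(0,1)` satisfying `d'∘d' = 0`, `d''∘d'' = 0` and
`d'∘d'' + d''∘d' = 0`. -/
structure BiComplex (W : Type*) [AddCommGroup W] [Module ℂ W] where
  A : ℤ → ℤ → Submodule ℂ W
  d' : W →ₗ[ℂ] W
  d'' : W →ₗ[ℂ] W
  internal : DirectSum.IsInternal (fun pq : ℤ × ℤ => A pq.1 pq.2)
  map_d' : ∀ p q : ℤ, (A p q).map d' ≤ A (p + 1) q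
  map_d'' : ∀ p q : ℤ, (A p q).map d'' ≤ A p (q + 1)
  d'_sq : d' ∘ₗ d' = 0
  d''_sq : d'' ∘ₗ d'' = 0
  anticomm : d' ∘ₗ d'' + d'' ∘ₗ d' = 0

namespace BiComplex

variable {W : Type*} [AddCommGroup W] [Module ℂ W] (C : BiComplex W)

/-- `ker d' ∩ A^{p,q}` : the kernel of `d' : A^{p,q} → A^{p+1,q}`. -/
def kerd' (p q : ℤ) : Submodule ℂ W := LinearMap.ker C.d' ⊓ C.A p q

/-- `ker d'' ∩ A^{p,q}` : the kernel of `d'' : A^{p,q} → A^{p,q+1}`. -/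
def kerd'' (p q : ℤ) : Submodule ℂ W := LinearMap.ker C.d'' ⊓ C.A p q

/-- `Im d' ∩ A^{p,q} = d'(A^{p-1,q})`. -/
def imd' (p q : ℤ) : Submodule ℂ W := (C.A (p - 1) q).map C.d'

/-- `Im d'' ∩ A^{p,q} = d''(A^{p,q-1})`. -/
def imd'' (p q : ℤ) : Submodule ℂ W := (C.A p (q - 1)).map C.d''

/-- `Im d'd'' ∩ A^{p,q} = (d'∘d'')(A^{p-1,q-1})`. -/
def imd'd'' (p q : ℤ) : Submodule ℂ W := (C.A (p - 1) (q - 1)).map (C.d' ∘ₗ C.d'')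

/-- `ker d'd'' ∩ A^{p,q}` : the kernel of `d'∘d'' : A^{p,q} → A^{p+1,q+1}`. -/
def kerd'd'' (p q : ℤ) : Submodule ℂ W := LinearMap.ker (C.d' ∘ₗ C.d'') ⊓ C.A p q

/-- The `d'd''`-lemma at `(p,q)`:
`Im d' ∩ ker d'' ∩ A^{p,q} = ker d' ∩ Im d'' ∩ A^{p,q} = Im d'd'' ∩ A^{p,q}`. -/
def DDLemmaAt (p q : ℤ) : Prop :=
  C.imd' p q ⊓ C.kerd'' p q = C.imd'd'' p q ∧ C.kerd' p q ⊓ C.imd'' p q = C.imd'd'' p q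

/-- The total-degree piece `A^k = ⊕_{p+q=k} A^{p,q}`. -/
def Atot (k : ℤ) : Submodule ℂ W := ⨆ p : ℤ, C.A p (k - p)

/-- The total differential `d = d' + d''`. -/
def dtot : W →ₗ[ℂ] W := C.d' + C.d''

/-- `ker d ∩ A^k` : the kernel of `d : A^k → A^{k+1}`. -/
def kerdTot (k : ℤ) : Submodule ℂ W := LinearMap.ker C.dtot ⊓ C.Atot k

/-- `Im d ∩ A^k = d(A^{k-1})`. -/
def imdTot (k : ℤ) : Submodule ℂ W := (C.Atot (k - 1)).map C.dtot

/-- `ker d' ∩ ker d'' ∩ A^k = ⊕_{p+q=k} (ker d' ∩ ker d'' ∩ A^{p,q})`. -/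
def kerd'kerd''Tot (k : ℤ) : Submodule ℂ W :=
  ⨆ p : ℤ, (C.kerd' p (k - p) ⊓ C.kerd'' p (k - p))

/-- `Im d'd'' ∩ A^k = ⊕_{p+q=k} (Im d'd'' ∩ A^{p,q})`. -/
def imd'd''Tot (k : ℤ) : Submodule ℂ W := ⨆ p : ℤ, C.imd'd'' p (k - p)

/-- `ker d'd'' ∩ A^k = ⊕_{p+q=k} (ker d'd'' ∩ A^{p,q})`. -/
def kerd'd''Tot (k : ℤ) : Submodule ℂ W := ⨆ p : ℤ, C.kerd'd'' p (k - p)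

/-- `Im d' ∩ A^k = ⊕_{p+q=k} (Im d' ∩ A^{p,q})`. -/
def imd'Tot (k : ℤ) : Submodule ℂ W := ⨆ p : ℤ, C.imd' p (k - p)

/-- `Im d'' ∩ A^k = ⊕_{p+q=k} (Im d'' ∩ A^{p,q})`. -/
def imd''Tot (k : ℤ) : Submodule ℂ W := ⨆ p : ℤ, C.imd'' p (k - p)

/-- The double complex is totally bounded: `A^{p,q} = 0` for `|p| > N` or `|q| > N`. -/
def TotallyBounded : Prop :=
  ∃ N : ℕ, ∀ p q : ℤ, ((N : ℤ) < |p| ∨ (N : ℤ) < |q|) → C.A p q = ⊥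

end BiComplex

/-- The quotient vector space `S / T` of a submodule `S` by (the trace of) a
submodule `T ≤ S`. -/
abbrev quotSub {W : Type*} [AddCommGroup W] [Module ℂ W] (S T : Submodule ℂ W) :=
  S ⧸ (Submodule.comap S.subtype T)

namespace BiComplex

variable {W : Type*} [AddCommGroup W] [Module ℂ W] (C : BiComplex W)

lemma d'_d'_apply (x : W) : C.d' (C.d' x) = 0 := LinearMap.congr_fun C.d'_sq x

lemma d''_d''_apply (x : W) : C.d'' (C.d'' x) = 0 := LinearMap.congr_fun C.d''_sq x

lemma d'_d''_apply (x : W) : C.d' (C.d'' x) = -C.d'' (C.d' x) :=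
  eq_neg_of_add_eq_zero_left (LinearMap.congr_fun C.anticomm x)

variable {C} {p q : ℤ} {x : W}

lemma d'_mem (hx : x ∈ C.A (p - 1) q) : C.d' x ∈ C.A p q := by
  simpa using C.map_d' (p - 1) q (mem_map_of_mem hx)

lemma d''_mem (hx : x ∈ C.A p (q - 1)) : C.d'' x ∈ C.A p q := by
  simpa using C.map_d'' p (q - 1) (mem_map_of_mem hx)

lemma imd'_le_kerd' : C.imd' p q ≤ C.kerd' p q := by
  rintro _ ⟨a, ha, rfl⟩
  exact ⟨C.d'_d'_apply a, d'_mem ha⟩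

lemma imd''_le_kerd'' : C.imd'' p q ≤ C.kerd'' p q := by
  rintro _ ⟨a, ha, rfl⟩
  exact ⟨C.d''_d''_apply a, d''_mem ha⟩

lemma imd'd''_le_imd' : C.imd'd'' p q ≤ C.imd' p q := by
  rintro _ ⟨a, ha, rfl⟩
  exact ⟨C.d'' a, d''_mem ha, rfl⟩

lemma imd'd''_le_imd'' : C.imd'd'' p q ≤ C.imd'' p q := by
  rintro _ ⟨a, ha, rfl⟩
  exact ⟨-C.d' a, neg_mem (d'_mem ha), by simp [d'_d''_apply]⟩

lemma kerd'_le_kerd'd'' : C.kerd' p q ≤ C.kerd'd'' p q := by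
  rintro x ⟨hx, hxA⟩
  rw [SetLike.mem_coe, LinearMap.mem_ker] at hx
  exact ⟨by simp [d'_d''_apply, hx], hxA⟩

lemma kerd''_le_kerd'd'' : C.kerd'' p q ≤ C.kerd'd'' p q := by
  rintro x ⟨hx, hxA⟩
  rw [SetLike.mem_coe, LinearMap.mem_ker] at hx
  exact ⟨by simp [hx], hxA⟩

/-- Under the `d'd''`-lemma, a `d'd''`-closed element becomes `d''`-closed after adding a
`d'`-exact one. -/
lemma exists_add_d'_mem_kerd'' (h : C.DDLemmaAt p (q + 1)) (hx : x ∈ C.kerd'd'' p q) :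
    ∃ y ∈ C.A (p - 1) q, x + C.d' y ∈ C.kerd'' p q := by
  obtain ⟨hx0, hxA⟩ := hx
  have hmem : C.d'' x ∈ C.kerd' p (q + 1) ⊓ C.imd'' p (q + 1) :=
    ⟨⟨hx0, C.map_d'' p q (mem_map_of_mem hxA)⟩, x, by simpa using hxA, rfl⟩
  rw [h.2] at hmem
  obtain ⟨y, hy, hyx⟩ := hmem
  rw [add_sub_cancel_right] at hy
  refine ⟨y, hy, ?_, add_mem hxA (d'_mem hy)⟩
  rw [LinearMap.comp_apply, d'_d''_apply] at hyx
  rw [SetLike.mem_coe, LinearMap.mem_ker, map_add, ← hyx, neg_add_cancel]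

/-- Under the `d'd''`-lemma, a `d'd''`-closed element becomes `d'`-closed after adding a
`d''`-exact one. -/
lemma exists_add_d''_mem_kerd' (h : C.DDLemmaAt (p + 1) q) (hx : x ∈ C.kerd'd'' p q) :
    ∃ y ∈ C.A p (q - 1), x + C.d'' y ∈ C.kerd' p q := by
  obtain ⟨hx0, hxA⟩ := hx
  rw [SetLike.mem_coe, LinearMap.mem_ker, LinearMap.comp_apply, d'_d''_apply, neg_eq_zero] at hx0
  have hmem : C.d' x ∈ C.imd' (p + 1) q ⊓ C.kerd'' (p + 1) q :=
    ⟨⟨x, by simpa using hxA, rfl⟩, hx0, C.map_d' p q (mem_map_of_mem hxA)⟩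
  rw [h.1] at hmem
  obtain ⟨y, hy, hyx⟩ := hmem
  rw [add_sub_cancel_right] at hy
  refine ⟨-y, neg_mem hy, ?_, add_mem hxA (d''_mem (neg_mem hy))⟩
  rw [LinearMap.comp_apply] at hyx
  rw [SetLike.mem_coe, LinearMap.mem_ker, map_add, map_neg, map_neg, hyx, add_neg_cancel]

lemma kerd'_eq_sup (h : C.DDLemmaAt p (q + 1)) :
    C.kerd' p q = (C.kerd' p q ⊓ C.kerd'' p q) ⊔ C.imd' p q := by
  refine le_antisymm (fun x hx => ?_) (sup_le inf_le_left imd'_le_kerd')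
  obtain ⟨y, hy, hxy⟩ := exists_add_d'_mem_kerd'' h (kerd'_le_kerd'd'' hx)
  have hdy : C.d' y ∈ C.imd' p q := mem_map_of_mem hy
  exact mem_sup.2 ⟨_, ⟨add_mem hx (imd'_le_kerd' hdy), hxy⟩, _, neg_mem hdy,
    add_neg_cancel_right _ _⟩

lemma kerd''_eq_sup (h : C.DDLemmaAt (p + 1) q) :
    C.kerd'' p q = (C.kerd' p q ⊓ C.kerd'' p q) ⊔ C.imd'' p q := by
  refine le_antisymm (fun x hx => ?_) (sup_le inf_le_right imd''_le_kerd'')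
  obtain ⟨y, hy, hxy⟩ := exists_add_d''_mem_kerd' h (kerd''_le_kerd'd'' hx)
  have hdy : C.d'' y ∈ C.imd'' p q := mem_map_of_mem hy
  exact mem_sup.2 ⟨_, ⟨hxy, add_mem hx (imd''_le_kerd'' hdy)⟩, _, neg_mem hdy,
    add_neg_cancel_right _ _⟩

lemma kerd'_inf_sup_eq (h : C.DDLemmaAt p q) :
    C.kerd' p q ⊓ (C.imd' p q ⊔ C.imd'' p q) = C.imd' p q := by
  rw [inf_comm, sup_inf_assoc_of_le _ imd'_le_kerd', inf_comm (C.imd'' p q), h.2,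
    sup_eq_left.2 imd'd''_le_imd']

lemma kerd''_inf_sup_eq (h : C.DDLemmaAt p q) :
    C.kerd'' p q ⊓ (C.imd' p q ⊔ C.imd'' p q) = C.imd'' p q := by
  rw [inf_comm, sup_comm, sup_inf_assoc_of_le _ imd''_le_kerd'', h.1,
    sup_eq_left.2 imd'd''_le_imd'']

lemma kerd'd''_eq_kerd'_sup_imd'' (h : C.DDLemmaAt (p + 1) q) :
    C.kerd'd'' p q = C.kerd' p q ⊔ C.imd'' p q := by
  refine le_antisymm (fun x hx => ?_)
    (sup_le kerd'_le_kerd'd'' (imd''_le_kerd''.trans kerd''_le_kerd'd''))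
  obtain ⟨y, hy, hxy⟩ := exists_add_d''_mem_kerd' h hx
  exact mem_sup.2 ⟨_, hxy, _, neg_mem (mem_map_of_mem hy), add_neg_cancel_right _ _⟩

lemma kerd'd''_eq_imd'_sup_kerd'' (h : C.DDLemmaAt p (q + 1)) :
    C.kerd'd'' p q = C.imd' p q ⊔ C.kerd'' p q := by
  refine le_antisymm (fun x hx => ?_)
    (sup_le (imd'_le_kerd'.trans kerd'_le_kerd'd'') kerd''_le_kerd'd'')
  obtain ⟨y, hy, hxy⟩ := exists_add_d'_mem_kerd'' h hx
  exact mem_sup.2 ⟨_, neg_mem (mem_map_of_mem hy), _, hxy, neg_add_cancel_comm_assoc _ _⟩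

end BiComplex

/-- If the double complex satisfies the `d'd''`-lemma at every
`(p,q)`, then at every `(p,q)` the natural maps `H_BC^{p,q} → H_{d'}^{p,q}`,
`H_BC^{p,q} → H_{d''}^{p,q}`, `H_{d'}^{p,q} → H_A^{p,q}` and
`H_{d''}^{p,q} → H_A^{p,q}` are all isomorphisms; equivalently, the eight listed
subspace equalities hold. -/
theorem bicomplex_ddlemma_implies_all_iso
    {W : Type*} [AddCommGroup W] [Module ℂ W] (C : BiComplex W)
    (h : ∀ p q : ℤ, C.DDLemmaAt p q) :
    ∀ p q : ℤ,
      C.imd' p q ⊓ C.kerd'' p q = C.imd'd'' p q ∧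
      C.kerd' p q ⊓ C.imd'' p q = C.imd'd'' p q ∧
      C.kerd' p q = (C.kerd' p q ⊓ C.kerd'' p q) ⊔ C.imd' p q ∧
      C.kerd'' p q = (C.kerd' p q ⊓ C.kerd'' p q) ⊔ C.imd'' p q ∧
      C.kerd' p q ⊓ (C.imd' p q ⊔ C.imd'' p q) = C.imd' p q ∧
      C.kerd'' p q ⊓ (C.imd' p q ⊔ C.imd'' p q) = C.imd'' p q ∧
      C.kerd'd'' p q = C.kerd' p q ⊔ C.imd'' p q ∧
      C.kerd'd'' p q = C.imd' p q ⊔ C.kerd'' p q := by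
  intro p q
  exact ⟨(h p q).1, (h p q).2, BiComplex.kerd'_eq_sup (h p (q + 1)),
    BiComplex.kerd''_eq_sup (h (p + 1) q), BiComplex.kerd'_inf_sup_eq (h p q),
    BiComplex.kerd''_inf_sup_eq (h p q), BiComplex.kerd'd''_eq_kerd'_sup_imd'' (h (p + 1) q),
    BiComplex.kerd'd''_eq_imd'_sup_kerd'' (h p (q + 1))⟩
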